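/- Let (M,ρ,μ) be an unbounded locally doubling metric measure space with the AMP property (constants R₀, β), let q ∈ [1,∞), and let R₀/(1−β) < c < b. Then BMO_b^q(μ) = BMO_c^q(μ) and the norms N_b^q and N_c^q are equivalent: N_c^q(f) ≤ N_b^q(f) ≤ C·N_c^q(f) for some constant C depending only on b, c, q and M. -/

import Mathlib

open MeasureTheory Metric Set ENNReal

variable {M : Type*} [MetricSpace M] [MeasurableSpace M]

/-- `K` is an upper bound for the mean `q`-oscillation of `f` over all balls of radius
at most `b`:  `∫_B |f − f_B|^q dμ ≤ K^q·μ(B)` for all such balls, where `f_B` is the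
mean of `f` on `B`. -/
def OscBound (μ : MeasureTheory.Measure M) (q b : ℝ) (f : M → ℝ) (K : ℝ) : Prop :=
  ∀ (x : M) (s : ℝ), 0 < s → s ≤ b →
    (∫⁻ y in Metric.ball x s,
        ENNReal.ofReal (|f y - ⨍ z in Metric.ball x s, f z ∂μ| ^ q) ∂μ)
      ≤ ENNReal.ofReal (K ^ q) * μ (Metric.ball x s)

/-- Membership in `BMO_b^q(μ)`: local integrability together with a finite uniform bound
on the mean `q`-oscillation over balls of radius at most `b`. -/
def MemBMO (μ : MeasureTheory.Measure M) (q b : ℝ) (f : M → ℝ) : Prop :=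
  MeasureTheory.LocallyIntegrable f μ ∧ ∃ K : ℝ, 0 ≤ K ∧ OscBound μ q b f K

/-- The `BMO_b^q(μ)` norm `N_b^q(f)`: the least uniform bound for the mean
`q`-oscillation of `f` over balls of radius at most `b`. -/
noncomputable def bmoNorm (μ : MeasureTheory.Measure M) (q b : ℝ) (f : M → ℝ) : ℝ :=
  sInf {K : ℝ | 0 ≤ K ∧ OscBound μ q b f K}

/-- The `q`-oscillation of `f` about `a` on `B` is at most `K`. -/
def OscAt (μ : Measure M) (q : ℝ) (f : M → ℝ) (B : Set M) (a K : ℝ) : Prop :=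
  (∫⁻ y in B, ENNReal.ofReal (|f y - a| ^ q) ∂μ) ≤ ENNReal.ofReal (K ^ q) * μ B

theorem OscAt.mono {μ : Measure M} {q : ℝ} (hq : 1 ≤ q) {f : M → ℝ} {B : Set M} {a K L : ℝ}
    (hK : 0 ≤ K) (hKL : K ≤ L) (h : OscAt μ q f B a K) : OscAt μ q f B a L := by
  refine le_trans h ?_
  gcongr

theorem OscAt.subset {μ : Measure M} {q : ℝ} (hq : 1 ≤ q) {f : M → ℝ} {B B' : Set M}
    {a K E : ℝ} (hK : 0 ≤ K) (hE : 1 ≤ E) (hB : B' ⊆ B)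
    (hμ : μ B ≤ ENNReal.ofReal E * μ B') (h : OscAt μ q f B a K) :
    OscAt μ q f B' a (E * K) := by
  have hE0 : 0 ≤ E := by linarith
  calc (∫⁻ y in B', ENNReal.ofReal (|f y - a| ^ q) ∂μ)
      ≤ ∫⁻ y in B, ENNReal.ofReal (|f y - a| ^ q) ∂μ := lintegral_mono_set hB
    _ ≤ ENNReal.ofReal (K ^ q) * μ B := h
    _ ≤ ENNReal.ofReal (K ^ q) * (ENNReal.ofReal E * μ B') := by gcongr
    _ = ENNReal.ofReal (K ^ q * E) * μ B' := by
        rw [ENNReal.ofReal_mul (by positivity), mul_assoc]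
    _ ≤ ENNReal.ofReal ((E * K) ^ q) * μ B' := by
        gcongr
        rw [Real.mul_rpow hE0 hK, mul_comm]
        gcongr
        calc E = E ^ (1 : ℝ) := (Real.rpow_one E).symm
          _ ≤ E ^ q := Real.rpow_le_rpow_of_exponent_le hE hq

theorem abs_add_rpow_le' {q : ℝ} (hq : 1 ≤ q) (u v L : ℝ) (hv : |v| ≤ L) :
    |u + v| ^ q ≤ 2 ^ q * (|u| ^ q + L ^ q) := by
  have hL : 0 ≤ L := (abs_nonneg v).trans hv
  have h1 : |u + v| ≤ 2 * max |u| L := by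
    have := abs_add_le u v
    have := le_max_left |u| L
    have := le_max_right |u| L
    linarith
  calc |u + v| ^ q ≤ (2 * max |u| L) ^ q := by gcongr
    _ = 2 ^ q * (max |u| L) ^ q := Real.mul_rpow (by norm_num) (by positivity)
    _ ≤ _ := by
      gcongr
      rcases max_cases |u| L with ⟨h, _⟩ | ⟨h, _⟩ <;> rw [h]
      · have : 0 ≤ L ^ q := by positivity
        linarith
      · have : 0 ≤ |u| ^ q := by positivity
        linarith

theorem OscAt.shift {μ : Measure M} {q : ℝ} (hq : 1 ≤ q) {f : M → ℝ} {B : Set M}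
    {a a' K L : ℝ} (hK : 0 ≤ K) (ha : |a - a'| ≤ L) (h : OscAt μ q f B a K) :
    OscAt μ q f B a' (4 * (K + L)) := by
  have hL : 0 ≤ L := (abs_nonneg _).trans ha
  have h2 : (0 : ℝ) ≤ 2 ^ q := by positivity
  calc (∫⁻ y in B, ENNReal.ofReal (|f y - a'| ^ q) ∂μ)
      ≤ ∫⁻ y in B, ENNReal.ofReal (2 ^ q) *
          (ENNReal.ofReal (|f y - a| ^ q) + ENNReal.ofReal (L ^ q)) ∂μ := by
        refine lintegral_mono fun y => ?_
        dsimp only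
        rw [← ENNReal.ofReal_add (by positivity) (by positivity), ← ENNReal.ofReal_mul h2]
        apply ENNReal.ofReal_le_ofReal
        have := abs_add_rpow_le' hq (f y - a) (a - a') L ha
        simpa using this
    _ = ENNReal.ofReal (2 ^ q) * ((∫⁻ y in B, ENNReal.ofReal (|f y - a| ^ q) ∂μ)
          + ENNReal.ofReal (L ^ q) * μ B) := by
        rw [lintegral_const_mul' _ _ ENNReal.ofReal_ne_top,
          lintegral_add_right _ measurable_const, setLIntegral_const]
    _ ≤ ENNReal.ofReal (2 ^ q) * (ENNReal.ofReal (K ^ q) * μ B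
          + ENNReal.ofReal (L ^ q) * μ B) := by
        gcongr
        exact h
    _ = ENNReal.ofReal (2 ^ q * (K ^ q + L ^ q)) * μ B := by
        rw [ENNReal.ofReal_mul h2, ENNReal.ofReal_add (by positivity) (by positivity)]
        ring
    _ ≤ ENNReal.ofReal ((4 * (K + L)) ^ q) * μ B := by
        gcongr
        have e : (4 * (K + L)) ^ q = 2 ^ q * (2 ^ q * (K + L) ^ q) := by
          rw [← Real.mul_rpow (by norm_num) (by positivity),
            ← Real.mul_rpow (by norm_num) (by positivity)]
          ring_nf
        rw [e]
        gcongr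
        have h3 : (2 : ℝ) ≤ 2 ^ q := by
          calc (2 : ℝ) = 2 ^ (1 : ℝ) := (Real.rpow_one 2).symm
            _ ≤ 2 ^ q := Real.rpow_le_rpow_of_exponent_le (by norm_num) hq
        have h4 : K ^ q ≤ (K + L) ^ q := by
          gcongr; linarith
        have h5 : L ^ q ≤ (K + L) ^ q := by
          gcongr; linarith
        have h6 : 0 ≤ (K + L) ^ q := by positivity
        nlinarith

theorem convexOn_abs_sub_rpow {q : ℝ} (hq : 1 ≤ q) (a : ℝ) :
    ConvexOn ℝ Set.univ (fun t : ℝ => |t - a| ^ q) := by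
  have h1 : ConvexOn ℝ Set.univ (fun t : ℝ => |t - a|) := by
    refine ⟨convex_univ, fun x _ y _ s t hs ht hst => ?_⟩
    have : s • x + t • y - a = s * (x - a) + t * (y - a) := by
      simp only [smul_eq_mul]
      linear_combination a * hst
    change |s • x + t • y - a| ≤ s * |x - a| + t * |y - a|
    rw [this]
    refine (abs_add_le _ _).trans ?_
    rw [abs_mul, abs_mul, abs_of_nonneg hs, abs_of_nonneg ht]
  refine ⟨convex_univ, fun x hx y hy s t hs ht hst => ?_⟩
  have h2 := h1.2 hx hy hs ht hst
  have h3 := (convexOn_rpow hq).2 (abs_nonneg (x - a)) (abs_nonneg (y - a)) hs ht hst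
  refine le_trans ?_ h3
  exact Real.rpow_le_rpow (abs_nonneg _) h2 (by linarith)

theorem OscAt.average {μ : Measure M} {q : ℝ} (hq : 1 ≤ q) {f : M → ℝ}
    (hf : AEStronglyMeasurable f μ) {B : Set M}
    (h0 : μ B ≠ 0) (hT : μ B ≠ ⊤)
    {a K : ℝ} (hK : 0 ≤ K) (h : OscAt μ q f B a K) :
    |(⨍ z in B, f z ∂μ) - a| ≤ K := by
  haveI : IsFiniteMeasure (μ.restrict B) := ⟨by simpa using hT.lt_top⟩
  haveI : NeZero (μ.restrict B) := ⟨by simpa using h0⟩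
  have hcont : Continuous (fun t : ℝ => |t - a| ^ q) :=
    (continuous_id.sub continuous_const).abs.rpow_const (fun _ => Or.inr (by linarith))
  have hfB : AEStronglyMeasurable f (μ.restrict B) := hf.restrict
  have hgi : Integrable (fun y => |f y - a| ^ q) (μ.restrict B) := by
    refine ⟨hcont.comp_aestronglyMeasurable hfB, ?_⟩
    rw [hasFiniteIntegral_iff_ofReal (Filter.Eventually.of_forall fun y => by positivity)]
    exact lt_of_le_of_lt h (ENNReal.mul_lt_top ENNReal.ofReal_lt_top hT.lt_top)
  have hfi : Integrable f (μ.restrict B) := by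
    refine Integrable.mono' ((integrable_const (1 + |a|)).add hgi) hfB
      (Filter.Eventually.of_forall fun y => ?_)
    have h1 : |f y| ≤ |f y - a| + |a| := by
      have := abs_add_le (f y - a) a
      simpa using this
    have h2 : |f y - a| ≤ 1 + |f y - a| ^ q := by
      rcases le_total |f y - a| 1 with h | h
      · have : 0 ≤ |f y - a| ^ q := by positivity
        linarith
      · have : |f y - a| ^ (1 : ℝ) ≤ |f y - a| ^ q := Real.rpow_le_rpow_of_exponent_le h hq
        rw [Real.rpow_one] at this
        linarith
    simp only [Pi.add_apply, Real.norm_eq_abs]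
    linarith
  have hJ := (convexOn_abs_sub_rpow hq a).map_average_le hcont.continuousOn isClosed_univ
    (Filter.Eventually.of_forall fun y => Set.mem_univ (f y)) hfi hgi
  have hm : 0 < μ.real B := ENNReal.toReal_pos h0 hT
  have hint : (∫ y in B, |f y - a| ^ q ∂μ) ≤ K ^ q * μ.real B := by
    have h1 := ofReal_integral_eq_lintegral_ofReal hgi
      (Filter.Eventually.of_forall fun y => by positivity)
    have h2 : ENNReal.ofReal (∫ y in B, |f y - a| ^ q ∂μ) ≤ ENNReal.ofReal (K ^ q * μ.real B) := by
      rw [h1, ENNReal.ofReal_mul (by positivity), ofReal_measureReal hT]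
      exact h
    exact (ENNReal.ofReal_le_ofReal_iff (by positivity)).1 h2
  have hav : (⨍ y in B, |f y - a| ^ q ∂μ) ≤ K ^ q := by
    rw [setAverage_eq, smul_eq_mul, inv_mul_le_iff₀ hm, mul_comm]
    exact hint
  have := hJ.trans hav
  exact (Real.rpow_le_rpow_iff (abs_nonneg _) hK (by linarith)).1 this

theorem exists_net (S : Set M) (c : ℝ) (hc : 0 < c) :
    ∃ T ⊆ S, (∀ x ∈ T, ∀ y ∈ T, x ≠ y → c ≤ dist x y) ∧ ∀ x ∈ S, ∃ y ∈ T, dist x y < c := by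
  obtain ⟨T, hT⟩ := zorn_subset
    {T : Set M | T ⊆ S ∧ ∀ x ∈ T, ∀ y ∈ T, x ≠ y → c ≤ dist x y} (by
      intro C hC hch
      refine ⟨⋃₀ C, ⟨Set.sUnion_subset fun t ht => (hC ht).1, ?_⟩,
        fun s hs => Set.subset_sUnion_of_mem hs⟩
      rintro x ⟨t, ht, hx⟩ y ⟨u, hu, hy⟩ hxy
      rcases hch.total ht hu with h | h
      · exact (hC hu).2 x (h hx) y hy hxy
      · exact (hC ht).2 x hx y (h hy) hxy)
  refine ⟨T, hT.prop.1, hT.prop.2, fun x hx => ?_⟩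
  by_contra! hcon
  have hmem : insert x T ∈ {T : Set M | T ⊆ S ∧ ∀ x ∈ T, ∀ y ∈ T, x ≠ y → c ≤ dist x y} := by
    refine ⟨Set.insert_subset hx hT.prop.1, ?_⟩
    rintro u (rfl | hu) v (rfl | hv) huv
    · exact absurd rfl huv
    · exact hcon v hv
    · rw [dist_comm]; exact hcon u hu
    · exact hT.prop.2 u hu v hv huv
  have hxT : x ∈ T := hT.le_of_ge hmem (Set.subset_insert x T) (Set.mem_insert x T)
  have := hcon x hxT
  simp at this
  linarith

theorem net_disjoint {T : Set M} {c : ℝ}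
    (hT : ∀ x ∈ T, ∀ y ∈ T, x ≠ y → c ≤ dist x y) :
    T.PairwiseDisjoint (fun y => ball y (c / 2)) := by
  intro x hx y hy hxy
  apply ball_disjoint_ball
  have := hT x hx y hy hxy
  linarith

theorem net_countable [BorelSpace M] {μ : Measure M} [SFinite μ]
    (hp : ∀ (x : M) (r : ℝ), 0 < r → 0 < μ (ball x r)) {T : Set M} {c : ℝ} (hc : 0 < c)
    (hT : ∀ x ∈ T, ∀ y ∈ T, x ≠ y → c ≤ dist x y) : T.Countable := by
  have h := Measure.countable_meas_pos_of_disjoint_iUnion (μ := μ)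
    (As := fun y : T => ball (y : M) (c / 2)) (fun _ => measurableSet_ball)
    (fun x y hxy => net_disjoint hT x.2 y.2 (fun h => hxy (Subtype.ext h)))
  have : {i : T | 0 < μ (ball (i : M) (c / 2))} = Set.univ := by
    ext i; simp [hp i (c / 2) (by linarith)]
  rw [this] at h
  exact Set.countable_coe_iff.1 (Set.countable_univ_iff.1 h)

theorem sfinite_of_balls [BorelSpace M] {μ : Measure M}
    (hballs : ∀ (x : M) (r : ℝ), μ (ball x r) < ⊤) : SigmaFinite μ := by
  rcases isEmpty_or_nonempty M with h | ⟨⟨x0⟩⟩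
  · have : μ = 0 := Measure.eq_zero_of_isEmpty μ
    rw [this]; infer_instance
  · exact ⟨⟨{ set := fun n => ball x0 n
              set_mem := fun _ => trivial
              finite := fun n => hballs x0 n
              spanning := iUnion_ball_nat x0 }⟩⟩

theorem balls_pos {μ : Measure M} (hpos : μ Set.univ ≠ 0)
    (hLD : ∀ b : ℝ, 0 < b → ∃ D : ℝ, ∀ (x : M) (s : ℝ), 0 < s → s ≤ b →
      μ (Metric.ball x (2 * s)) ≤ ENNReal.ofReal D * μ (Metric.ball x s))
    (x : M) (r : ℝ) (hr : 0 < r) : 0 < μ (ball x r) := by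
  rw [pos_iff_ne_zero]
  intro h0
  have h1 : ∀ n : ℕ, μ (ball x (2 ^ n * r)) = 0 := by
    intro n
    induction n with
    | zero => simpa using h0
    | succ n ih =>
      obtain ⟨D, hD⟩ := hLD (2 ^ n * r) (by positivity)
      have := hD x (2 ^ n * r) (by positivity) le_rfl
      rw [ih, mul_zero] at this
      rw [pow_succ', mul_assoc]
      simpa using this
  apply hpos
  have : (⋃ n : ℕ, ball x (2 ^ n * r)) = Set.univ := by
    refine Set.eq_univ_of_forall fun y => Set.mem_iUnion.2 ?_
    obtain ⟨n, hn⟩ := pow_unbounded_of_one_lt (dist y x / r) (one_lt_two)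
    exact ⟨n, by rw [mem_ball]; rwa [div_lt_iff₀ hr] at hn⟩
  rw [← this]
  exact measure_iUnion_null h1

theorem secondCountable_of_balls [BorelSpace M] {μ : Measure M} [SFinite μ]
    (hp : ∀ (x : M) (r : ℝ), 0 < r → 0 < μ (ball x r)) : SecondCountableTopology M := by
  refine Metric.secondCountable_of_almost_dense_set fun ε hε => ?_
  obtain ⟨T, -, hsep, hcov⟩ := exists_net (Set.univ : Set M) ε hε
  refine ⟨T, net_countable hp hε hsep, fun x => ?_⟩
  obtain ⟨y, hy, hxy⟩ := hcov x trivial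
  exact ⟨y, hy, hxy.le⟩

theorem osc_scale [BorelSpace M] (μ : Measure M)
    (hballs : ∀ (x : M) (r : ℝ), μ (Metric.ball x r) < ⊤)
    (hp : ∀ (x : M) (r : ℝ), 0 < r → 0 < μ (ball x r))
    (hLD : ∀ b : ℝ, 0 < b → ∃ D : ℝ, ∀ (x : M) (s : ℝ), 0 < s → s ≤ b →
      μ (Metric.ball x (2 * s)) ≤ ENNReal.ofReal D * μ (Metric.ball x s))
    (R₀ β : ℝ) (hR₀ : 0 ≤ R₀) (hβ₁ : 1 / 2 < β) (hβ₂ : β < 1)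
    (hAMP : ∀ x y : M, R₀ < dist x y → ∃ (z : M) (s : ℝ),
      s < β * dist x y ∧ x ∈ Metric.ball z s ∧ y ∈ Metric.ball z s)
    (q : ℝ) (hq : 1 ≤ q)
    (b c : ℝ) (hc : R₀ / (1 - β) < c) (hcb : c < b) :
    ∃ C : ℝ, 0 < C ∧ ∀ f : M → ℝ, AEStronglyMeasurable f μ → ∀ K : ℝ, 0 ≤ K →
      OscBound μ q c f K → OscBound μ q b f (C * K) := by
  haveI := sfinite_of_balls hballs
  have hc0 : 0 < c := lt_of_le_of_lt (div_nonneg hR₀ (by linarith)) hc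
  have hRc : R₀ < c / 2 := by
    rw [div_lt_iff₀ (by linarith)] at hc
    nlinarith
  obtain ⟨D', hD'⟩ := hLD b (by linarith)
  set D := max D' 1 with hDdef
  have hD1 : 1 ≤ D := le_max_right _ _
  have hD : ∀ (x : M) (s : ℝ), 0 < s → s ≤ b →
      μ (Metric.ball x (2 * s)) ≤ ENNReal.ofReal D * μ (Metric.ball x s) := by
    intro x s hs hsb
    refine (hD' x s hs hsb).trans ?_
    gcongr
    exact le_max_left _ _
  have hDD : 1 ≤ D * D := by nlinarith
  -- number of halvings
  obtain ⟨k, hk⟩ := exists_pow_lt_of_lt_one (show 0 < c / 2 / b by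
    have : 0 < b := by linarith
    positivity) hβ₂
  have hkb : β ^ k * b < c / 2 := by
    rwa [lt_div_iff₀ (by linarith)] at hk
  set A : ℝ := 2 ^ k * (2 * (D * D)) with hA
  have hA0 : 0 < A := by positivity
  refine ⟨32 * (D * D) * (1 + A), by positivity, fun f hf K hK hosc => ?_⟩
  have hbase : ∀ x y : M, dist x y ≤ c / 2 →
      |(⨍ z in ball x c, f z ∂μ) - ⨍ z in ball y c, f z ∂μ| ≤ 2 * (D * D) * K := by
    intro x y hxy
    have hmy : ∀ B : Set M, B ⊆ ball y (2 * c) →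
        μ B ≤ ENNReal.ofReal (D * D) * μ (ball y (c / 2)) := by
      intro B hB
      calc μ B ≤ μ (ball y (2 * c)) := measure_mono hB
        _ ≤ ENNReal.ofReal D * μ (ball y c) := hD y c hc0 hcb.le
        _ = ENNReal.ofReal D * μ (ball y (2 * (c / 2))) := by congr 3; ring
        _ ≤ ENNReal.ofReal D * (ENNReal.ofReal D * μ (ball y (c / 2))) := by
            gcongr
            exact hD y (c / 2) (by linarith) (by linarith)
        _ = _ := by rw [ENNReal.ofReal_mul (by linarith), mul_assoc]
    have h1 : |(⨍ z in ball y (c / 2), f z ∂μ) - ⨍ z in ball x c, f z ∂μ| ≤ D * D * K := by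
      refine OscAt.average hq hf (hp _ _ (by linarith)).ne' (hballs _ _).ne (by positivity)
        (OscAt.subset hq hK hDD (B := ball x c) (ball_subset_ball' ?_)
          (hmy _ (ball_subset_ball' ?_)) (hosc x c hc0 le_rfl))
      · rw [dist_comm]; linarith
      · linarith
    have h2 : |(⨍ z in ball y (c / 2), f z ∂μ) - ⨍ z in ball y c, f z ∂μ| ≤ D * D * K := by
      refine OscAt.average hq hf (hp _ _ (by linarith)).ne' (hballs _ _).ne (by positivity)
        (OscAt.subset hq hK hDD (B := ball y c) (ball_subset_ball ?_)
          (hmy _ (ball_subset_ball ?_)) (hosc y c hc0 le_rfl))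
      · linarith
      · linarith
    rw [abs_le] at *
    constructor <;> linarith [h1.1, h1.2, h2.1, h2.2]
  have hchain : ∀ (n : ℕ) (x y : M), β ^ n * dist x y ≤ c / 2 →
      |(⨍ z in ball x c, f z ∂μ) - ⨍ z in ball y c, f z ∂μ| ≤ 2 ^ n * (2 * (D * D) * K) := by
    intro n
    induction n with
    | zero => intro x y h; simpa using hbase x y (by simpa using h)
    | succ n ih =>
      intro x y h
      rcases le_or_gt (dist x y) R₀ with hd | hd
      · refine (hbase x y (by linarith)).trans ?_
        have : (1 : ℝ) ≤ 2 ^ (n + 1) := one_le_pow₀ (by norm_num)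
        have h0 : 0 ≤ 2 * (D * D) * K := by positivity
        nlinarith
      · obtain ⟨w, s, hs, hx, hy⟩ := hAMP x y hd
        rw [mem_ball] at hx hy
        have hβn : 0 < β ^ n := by positivity
        have e1 : β ^ n * dist x w ≤ c / 2 := by
          refine le_trans ?_ h
          rw [pow_succ, mul_assoc]
          gcongr
          linarith
        have e2 : β ^ n * dist w y ≤ c / 2 := by
          refine le_trans ?_ h
          rw [pow_succ, mul_assoc]
          gcongr
          rw [dist_comm]; linarith
        have i1 := ih x w e1
        have i2 := ih w y e2
        rw [pow_succ]
        rw [abs_le] at *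
        constructor <;> linarith [i1.1, i1.2, i2.1, i2.2]
  intro x s hs hsb
  change OscAt μ q f (ball x s) _ _
  rcases le_or_gt s c with hsc | hsc
  · refine OscAt.mono hq hK ?_ (hosc x s hs hsc)
    have : 1 ≤ 32 * (D * D) * (1 + A) := by nlinarith
    nlinarith
  set a := ⨍ z in ball x c, f z ∂μ with ha
  set K1 := 4 * (K + A * K) with hK1
  have hK10 : 0 ≤ K1 := by positivity
  have hloc : ∀ y ∈ ball x s, OscAt μ q f (ball y c) a K1 := by
    intro y hy
    refine OscAt.shift hq hK ?_ (hosc y c hc0 le_rfl)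
    have := hchain k y x (by
      rw [mem_ball] at hy
      have : 0 < β ^ k := by positivity
      nlinarith)
    refine this.trans (le_of_eq ?_)
    rw [hA]; ring
  obtain ⟨T, hTs, hsep, hcov⟩ := exists_net (ball x s) c hc0
  have hTc := net_countable hp hc0 hsep
  have hcount : Countable T := hTc.to_subtype
  have hbig : OscAt μ q f (ball x s) a (D * D * K1) := by
    calc (∫⁻ y in ball x s, ENNReal.ofReal (|f y - a| ^ q) ∂μ)
        ≤ ∫⁻ y in ⋃ i : T, ball (i : M) c, ENNReal.ofReal (|f y - a| ^ q) ∂μ := by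
          refine lintegral_mono_set fun z hz => ?_
          obtain ⟨y, hy, hzy⟩ := hcov z hz
          exact Set.mem_iUnion.2 ⟨⟨y, hy⟩, hzy⟩
      _ ≤ ∑' i : T, ∫⁻ y in ball (i : M) c, ENNReal.ofReal (|f y - a| ^ q) ∂μ :=
          lintegral_iUnion_le _ _
      _ ≤ ∑' i : T, ENNReal.ofReal (K1 ^ q) * (ENNReal.ofReal D * μ (ball (i : M) (c / 2))) := by
          refine ENNReal.tsum_le_tsum fun i => ?_
          refine (hloc i (hTs i.2)).trans ?_
          gcongr
          have := hD i (c / 2) (by linarith) (by linarith)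
          rwa [show 2 * (c / 2) = c by ring] at this
      _ = ENNReal.ofReal (K1 ^ q) * (ENNReal.ofReal D * μ (⋃ y ∈ T, ball y (c / 2))) := by
          rw [ENNReal.tsum_mul_left, ENNReal.tsum_mul_left,
            measure_biUnion hTc (net_disjoint hsep) (fun _ _ => measurableSet_ball)]
      _ ≤ ENNReal.ofReal (K1 ^ q) * (ENNReal.ofReal D * μ (ball x (2 * s))) := by
          gcongr
          refine Set.iUnion₂_subset fun y hy => ball_subset_ball' ?_
          have := mem_ball.1 (hTs hy)
          linarith
      _ ≤ ENNReal.ofReal (K1 ^ q) * (ENNReal.ofReal D * (ENNReal.ofReal D * μ (ball x s))) := by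
          gcongr
          exact hD x s hs hsb
      _ = ENNReal.ofReal (K1 ^ q * (D * D)) * μ (ball x s) := by
          rw [ENNReal.ofReal_mul (by positivity), ENNReal.ofReal_mul (by linarith)]
          ring
      _ ≤ ENNReal.ofReal ((D * D * K1) ^ q) * μ (ball x s) := by
          gcongr
          rw [Real.mul_rpow (by linarith) hK10, mul_comm]
          gcongr
          calc D * D = (D * D) ^ (1 : ℝ) := (Real.rpow_one _).symm
            _ ≤ (D * D) ^ q := Real.rpow_le_rpow_of_exponent_le hDD hq
  have hav := OscAt.average hq hf (hp x s hs).ne' (hballs x s).ne (by positivity) hbig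
  rw [abs_sub_comm] at hav
  have := OscAt.shift hq (by positivity) hav hbig
  refine OscAt.mono hq (by positivity) (le_of_eq ?_) this
  rw [hK1]; ring

/-- In an unbounded, locally doubling metric measure space with the
approximate midpoint property (constants `R₀, β`), for `q ∈ [1,∞)` and
`R₀/(1−β) < c < b`, the spaces `BMO_b^q(μ)` and `BMO_c^q(μ)` coincide and the
norms `N_b^q` and `N_c^q` are equivalent: `N_c^q(f) ≤ N_b^q(f) ≤ C·N_c^q(f)`. -/
theorem bmo_scale_invariance
    {M : Type*} [MetricSpace M] [MeasurableSpace M] [BorelSpace M]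
    (μ : Measure M)
    (hpos : μ Set.univ ≠ 0)
    (hballs : ∀ (x : M) (r : ℝ), μ (Metric.ball x r) < ⊤)
    (hunb : ¬ Bornology.IsBounded (Set.univ : Set M))
    (hLD : ∀ b : ℝ, 0 < b → ∃ D : ℝ, ∀ (x : M) (s : ℝ), 0 < s → s ≤ b →
      μ (Metric.ball x (2 * s)) ≤ ENNReal.ofReal D * μ (Metric.ball x s))
    (R₀ β : ℝ) (hR₀ : 0 ≤ R₀) (hβ₁ : 1 / 2 < β) (hβ₂ : β < 1)
    (hAMP : ∀ x y : M, R₀ < dist x y → ∃ (z : M) (s : ℝ),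
      s < β * dist x y ∧ x ∈ Metric.ball z s ∧ y ∈ Metric.ball z s)
    (q : ℝ) (hq : 1 ≤ q)
    (b c : ℝ) (hc : R₀ / (1 - β) < c) (hcb : c < b) :
    (∀ f : M → ℝ, MemBMO μ q c f ↔ MemBMO μ q b f) ∧
    ∃ C : ℝ, 0 < C ∧ ∀ f : M → ℝ, MemBMO μ q b f →
      bmoNorm μ q c f ≤ bmoNorm μ q b f ∧
      bmoNorm μ q b f ≤ C * bmoNorm μ q c f := by
  haveI := sfinite_of_balls hballs
  have hp := balls_pos hpos hLD
  haveI := secondCountable_of_balls hp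
  obtain ⟨C, hC, hmain⟩ := osc_scale μ hballs hp hLD R₀ β hR₀ hβ₁ hβ₂ hAMP q hq b c hc hcb
  have hdown : ∀ (f : M → ℝ) (K : ℝ), OscBound μ q b f K → OscBound μ q c f K :=
    fun f K h x s hs hsc => h x s hs (hsc.trans hcb.le)
  have hbdd : ∀ (t : ℝ) (f : M → ℝ), BddBelow {K : ℝ | 0 ≤ K ∧ OscBound μ q t f K} :=
    fun t f => ⟨0, fun K hK => hK.1⟩
  refine ⟨fun f => ⟨?_, ?_⟩, C, hC, ?_⟩
  · rintro ⟨hf, K, hK, h⟩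
    exact ⟨hf, C * K, by positivity, hmain f hf.aestronglyMeasurable K hK h⟩
  · rintro ⟨hf, K, hK, h⟩
    exact ⟨hf, K, hK, hdown f K h⟩
  · rintro f ⟨hf, K, hK, h⟩
    refine ⟨csInf_le_csInf (hbdd c f) ⟨K, hK, h⟩ fun L hL => ⟨hL.1, hdown f L hL.2⟩, ?_⟩
    rw [← div_le_iff₀' hC]
    refine le_csInf ⟨K, hK, hdown f K h⟩ fun L hL => ?_
    rw [div_le_iff₀' hC]
    exact csInf_le (hbdd b f)
      ⟨mul_nonneg hC.le hL.1, hmain f hf.aestronglyMeasurable L hL.1 hL.2⟩
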